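/- Let (V, ω) be a symplectic vector space, (τ, ν) a polarization of V, and K, L Lagrangian subspaces each transverse to ν. For x ∈ τ let m_x ∈ ν be the unique element with x + m_x ∈ L. Then φ(x) = x + m_x defines a linear isomorphism φ : τ → L, and, regarding (L, ν) as a polarization, one has K^{(τ,ν)}(x) = K^{(L,ν)}(φ(x)) + L^{(τ,ν)}(x) for every x ∈ τ. -/

import Mathlib

open Module

variable {V : Type*} [AddCommGroup V] [Module ℝ V]

/-- The `ω`-orthogonal complement of a subspace `W`:
`W^⊥ = {v ∈ V : ω(v, x) = 0 for all x ∈ W}`. -/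
def SympOrtho (ω : V →ₗ[ℝ] V →ₗ[ℝ] ℝ) (W : Submodule ℝ V) : Submodule ℝ V :=
  ⨅ x ∈ W, LinearMap.ker (ω.flip x)

/-- A symplectic form: a nondegenerate alternating bilinear form. -/
def IsSymplectic (ω : V →ₗ[ℝ] V →ₗ[ℝ] ℝ) : Prop :=
  (∀ v : V, (∀ w : V, ω v w = 0) → v = 0) ∧ ∀ v : V, ω v v = 0

/-- A subspace is Lagrangian if it equals its `ω`-orthogonal complement. -/
def IsLagrangian (ω : V →ₗ[ℝ] V →ₗ[ℝ] ℝ) (L : Submodule ℝ V) : Prop :=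
  SympOrtho ω L = L

/-- `PosRel ω X Y Z` says `X ≻_Z Y` (with respect to the polarization `(Y, Z)`):
for every nonzero `x ∈ Y` and every `m ∈ Z` with `x + m ∈ X` (such an `m` exists and
is unique since `V = X ⊕ Z`), one has `ω(m, x) > 0`; i.e. the quadratic form
`X^{(Y,Z)}` is positive definite. -/
def PosRel (ω : V →ₗ[ℝ] V →ₗ[ℝ] ℝ) (X Y Z : Submodule ℝ V) : Prop :=
  ∀ x ∈ Y, x ≠ 0 → ∀ m ∈ Z, x + m ∈ X → 0 < ω m x

/-- `NegRel ω X Y Z` says `X ≺_Z Y`: the quadratic form `X^{(Y,Z)}` is negative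
definite. -/
def NegRel (ω : V →ₗ[ℝ] V →ₗ[ℝ] ℝ) (X Y Z : Submodule ℝ V) : Prop :=
  ∀ x ∈ Y, x ≠ 0 → ∀ m ∈ Z, x + m ∈ X → ω m x < 0

theorem mem_sympOrtho {ω : V →ₗ[ℝ] V →ₗ[ℝ] ℝ} {W : Submodule ℝ V} {v : V} :
    v ∈ SympOrtho ω W ↔ ∀ x ∈ W, ω v x = 0 := by
  simp [SympOrtho]

theorem IsLagrangian.apply_eq_zero {ω : V →ₗ[ℝ] V →ₗ[ℝ] ℝ} {L : Submodule ℝ V}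
    (hL : IsLagrangian ω L) {x y : V} (hx : x ∈ L) (hy : y ∈ L) : ω x y = 0 :=
  mem_sympOrtho.1 (hL.symm ▸ hx : x ∈ SympOrtho ω L) y hy

/-- A subspace of a symplectic vector space with trivial orthogonal complement is everything. -/
theorem IsSymplectic.eq_top_of_sympOrtho_eq_bot [FiniteDimensional ℝ V]
    {ω : V →ₗ[ℝ] V →ₗ[ℝ] ℝ} (hω : IsSymplectic ω) {W : Submodule ℝ V}
    (hW : SympOrtho ω W = ⊥) : W = ⊤ := by
  by_contra hne
  obtain ⟨f, hf, hWf⟩ := W.exists_le_ker_of_lt_top (lt_top_iff_ne_top.2 hne)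
  have hinj : Function.Injective ω := (injective_iff_map_eq_zero ω).2 fun v hv =>
    hω.1 v fun w => by simp [hv]
  have hsurj : Function.Surjective ω :=
    (LinearMap.injective_iff_surjective_of_finrank_eq_finrank
      (Subspace.dual_finrank_eq (K := ℝ) (V := V)).symm).1 hinj
  obtain ⟨v, rfl⟩ := hsurj f
  have hv : v ∈ SympOrtho ω W := mem_sympOrtho.2 fun x hx => hWf hx
  rw [hW, Submodule.mem_bot] at hv
  exact hf (by rw [hv, map_zero])

/-- Transverse Lagrangian subspaces are complementary. -/
theorem IsLagrangian.isCompl [FiniteDimensional ℝ V] {ω : V →ₗ[ℝ] V →ₗ[ℝ] ℝ}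
    (hω : IsSymplectic ω) {L M : Submodule ℝ V} (hL : IsLagrangian ω L)
    (hM : IsLagrangian ω M) (h : L ⊓ M = ⊥) : IsCompl L M := by
  refine ⟨disjoint_iff.2 h, codisjoint_iff.2 (hω.eq_top_of_sympOrtho_eq_bot ?_)⟩
  refine (Submodule.eq_bot_iff _).2 fun v hv => ?_
  rw [mem_sympOrtho] at hv
  have hvL : v ∈ L := hL ▸ mem_sympOrtho.2 fun x hx => hv x (Submodule.mem_sup_left hx)
  have hvM : v ∈ M := hM ▸ mem_sympOrtho.2 fun x hx => hv x (Submodule.mem_sup_right hx)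
  exact (Submodule.mem_bot ℝ).1 (h ▸ Submodule.mem_inf.2 ⟨hvL, hvM⟩)

/-- Let (V, ω) be a symplectic vector space, (τ, ν) a polarization and K, L Lagrangian
subspaces each transverse to ν. For x ∈ τ let m_x ∈ ν be the unique element with
x + m_x ∈ L. Then φ(x) = x + m_x defines a linear isomorphism φ : τ → L (the unique
existence of m_x, additivity, injectivity and surjectivity onto L are stated below),
and, regarding (L, ν) as a polarization, K^{(τ,ν)}(x) = K^{(L,ν)}(φ(x)) + L^{(τ,ν)}(x)
for every x ∈ τ: in terms of representatives, if m ∈ ν with x + m ∈ L and m' ∈ ν with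
(x + m) + m' ∈ K, then ω(m + m', x) = ω(m', x + m) + ω(m, x). -/
theorem lagrangian_quadratic_form_additivity [FiniteDimensional ℝ V]
    (ω : V →ₗ[ℝ] V →ₗ[ℝ] ℝ) (hω : IsSymplectic ω)
    (τ ν K L : Submodule ℝ V)
    (hτ : IsLagrangian ω τ) (hν : IsLagrangian ω ν) (hτν : τ ⊓ ν = ⊥)
    (hK : IsLagrangian ω K) (hKν : K ⊓ ν = ⊥)
    (hL : IsLagrangian ω L) (hLν : L ⊓ ν = ⊥) :
    -- φ is well defined
    (∀ x ∈ τ, ∃! m : V, m ∈ ν ∧ x + m ∈ L) ∧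
    -- φ is additive (hence, with the scalar clause below, linear)
    (∀ x ∈ τ, ∀ x' ∈ τ, ∀ m ∈ ν, ∀ m' ∈ ν, x + m ∈ L → x' + m' ∈ L →
      (x + x') + (m + m') ∈ L) ∧
    (∀ (c : ℝ), ∀ x ∈ τ, ∀ m ∈ ν, x + m ∈ L → c • x + c • m ∈ L) ∧
    -- φ is injective
    (∀ x ∈ τ, ∀ x' ∈ τ, ∀ m ∈ ν, ∀ m' ∈ ν,
      x + m ∈ L → x' + m' ∈ L → x + m = x' + m' → x = x') ∧
    -- φ is surjective onto L
    (∀ l ∈ L, ∃ x ∈ τ, ∃ m ∈ ν, l = x + m) ∧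
    -- the quadratic form identity K^{(τ,ν)} = K^{(L,ν)} ∘ φ + L^{(τ,ν)}
    (∀ x ∈ τ, ∀ m ∈ ν, x + m ∈ L → ∀ m' ∈ ν, (x + m) + m' ∈ K →
      ω (m + m') x = ω m' (x + m) + ω m x) := by
  have eq_zero_of_mem {P : Submodule ℝ V} (hP : P ⊓ ν = ⊥) {v : V} (hv : v ∈ P) (hv' : v ∈ ν) :
      v = 0 := (Submodule.mem_bot ℝ).1 (hP ▸ Submodule.mem_inf.2 ⟨hv, hv'⟩)
  refine ⟨fun x _ => ?_, ?_, ?_, ?_, fun l _ => ?_, ?_⟩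
  · obtain ⟨l, hl, n, hn, rfl⟩ := Submodule.mem_sup.1
      ((hL.isCompl hω hν hLν).sup_eq_top ▸ Submodule.mem_top : x ∈ L ⊔ ν)
    refine ⟨-n, ⟨ν.neg_mem hn, by simpa using hl⟩, fun m ⟨hm, hmL⟩ => ?_⟩
    refine eq_neg_of_add_eq_zero_right (eq_zero_of_mem hLν ?_ (ν.add_mem hn hm))
    simpa [add_assoc] using L.sub_mem hmL hl
  · intro x _ x' _ m _ m' _ h h'
    rw [add_add_add_comm]
    exact L.add_mem h h'
  · intro c x _ m _ h
    rw [← smul_add]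
    exact L.smul_mem c h
  · intro x hx x' hx' m hm m' hm' _ _ h
    refine sub_eq_zero.1 (eq_zero_of_mem hτν (τ.sub_mem hx hx') ?_)
    rw [show x - x' = m' - m by rw [sub_eq_sub_iff_add_eq_add, h, add_comm]]
    exact ν.sub_mem hm' hm
  · obtain ⟨x, hx, m, hm, h⟩ := Submodule.mem_sup.1
      ((hτ.isCompl hω hν hτν).sup_eq_top ▸ Submodule.mem_top : l ∈ τ ⊔ ν)
    exact ⟨x, hx, m, hm, h.symm⟩
  · intro x _ m hm _ m' hm' _
    simp [hν.apply_eq_zero hm' hm, add_comm]
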